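/- arXiv:2011.07527 — 3 statements merged into one kernel-verified Lean document; each statement's English description precedes it below -/
import Mathlib

section
/- Let w > 0 and q = e^{−w} ∈ (0,1). Let α ∈ ℂ, set a = q^α = e^{−wα}, and assume a ∉ q^ℤ. Let Q ∈ ℂ∖[0,∞) with Q ∉ q^ℤ, so that −Q ∈ ℂ∖(−∞,0] and log(−Q) denotes the principal logarithm, and set (−Q)^{−α} = exp(−α log(−Q)). Then the bilateral series below converges absolutely and Σ_{m=−∞}^{∞} csc(απ − 2mπ²i w^{−1}) · exp(2mπi w^{−1} log(−Q)) · (−Q)^{−α} = w (q;q)_∞ (q;q)_∞ (aQ;q)_∞ (q/(aQ);q)_∞ / [π (a;q)_∞ (q/a;q)_∞ (Q;q)_∞ (q/Q;q)_∞]. -/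
/-- The infinite q-Pochhammer symbol `(a;q)_∞ = ∏_{k=0}^∞ (1 − a q^k)`. -/
noncomputable def qPochInf (q a : ℂ) : ℂ := ∏' k : ℕ, (1 - a * q ^ k)

open Filter Topology Set

namespace QSeries

section Pochhammer

variable {q : ℂ}

lemma summable_norm_mul_pow (hq : ‖q‖ < 1) (a : ℂ) : Summable fun k : ℕ => ‖-(a * q ^ k)‖ := by
  simpa [norm_mul, norm_pow] using
    (summable_geometric_of_lt_one (norm_nonneg _) hq).mul_left ‖a‖

lemma multipliable_one_sub_mul_pow (hq : ‖q‖ < 1) (a : ℂ) :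
    Multipliable fun k : ℕ => 1 - a * q ^ k := by
  simpa [sub_eq_add_neg] using multipliable_one_add_of_summable (summable_norm_mul_pow hq a)

lemma qPochInf_eq_mul (hq : ‖q‖ < 1) (a : ℂ) :
    qPochInf q a = (1 - a) * qPochInf q (q * a) := by
  have h : (fun k : ℕ => 1 - a * q ^ (k + 1)) = fun k : ℕ => 1 - (q * a) * q ^ k := by
    ext k; ring
  unfold qPochInf
  rw [tprod_eq_zero_mul' (h ▸ multipliable_one_sub_mul_pow hq (q * a)), h]
  simp

lemma qPochInf_ne_zero (hq : ‖q‖ < 1) {a : ℂ} (ha : ∀ k : ℕ, a * q ^ k ≠ 1) :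
    qPochInf q a ≠ 0 := by
  have := tprod_one_add_ne_zero_of_summable (f := fun k : ℕ => -(a * q ^ k))
    (fun k => by simpa [← sub_eq_add_neg, sub_eq_zero] using (ha k).symm)
    (summable_norm_mul_pow hq a)
  simpa [qPochInf, sub_eq_add_neg] using this

lemma differentiable_qPochInf (hq : ‖q‖ < 1) : Differentiable ℂ (qPochInf q) := by
  intro x
  have hu := (summable_geometric_of_lt_one (norm_nonneg _) hq).mul_left (‖x‖ + 1)
  have hK : IsOpen (Metric.ball (0 : ℂ) (‖x‖ + 1)) := Metric.isOpen_ball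
  have h := hu.hasProdLocallyUniformlyOn_nat_one_add (f := fun (k : ℕ) (a : ℂ) => -(a * q ^ k)) hK
    (.of_forall fun n a ha => by
      have : ‖a‖ ≤ ‖x‖ + 1 := by simpa using (mem_ball_zero_iff.1 ha).le
      simpa [norm_mul, norm_pow] using! mul_le_mul_of_nonneg_right this (by positivity))
    (fun n => by fun_prop)
  have hd := h.differentiableOn (.of_forall fun s => by
    simpa [Finset.prod_fn] using DifferentiableOn.finsetProd (fun _ _ => by fun_prop)) hK
  have := hd.differentiableAt (hK.mem_nhds (x := x) (by simp))
  unfold qPochInf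
  simpa [sub_eq_add_neg] using! this

/-- The modified theta function `(x;q)_∞ (q/x;q)_∞`. -/
noncomputable def qTheta (q x : ℂ) : ℂ := qPochInf q x * qPochInf q (q / x)

lemma qPochInf_one (hq : ‖q‖ < 1) : qPochInf q 1 = 0 := by
  rw [qPochInf_eq_mul hq]; simp

lemma qTheta_mul (hq : ‖q‖ < 1) (hq0 : q ≠ 0) {x : ℂ} (hx : x ≠ 0) :
    qTheta q (q * x) = -x⁻¹ * qTheta q x := by
  unfold qTheta
  have h1 : q / (q * x) = x⁻¹ := by field_simp
  have h2 := qPochInf_eq_mul hq x⁻¹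
  rw [← div_eq_mul_inv] at h2
  rw [h1, h2, qPochInf_eq_mul hq x]
  field_simp
  ring

lemma qTheta_zpow (hq : ‖q‖ < 1) (hq0 : q ≠ 0) (k : ℤ) : qTheta q (q ^ k) = 0 := by
  induction k using Int.induction_on with
  | zero => simp [qTheta, qPochInf_one hq]
  | succ n ih =>
    rw [zpow_add_one₀ hq0, mul_comm, qTheta_mul hq hq0 (zpow_ne_zero _ hq0), ih, mul_zero]
  | pred n ih =>
    have h := qTheta_mul hq hq0 (zpow_ne_zero (-(n : ℤ) - 1) hq0)
    rw [← zpow_one_add₀ hq0, add_sub_cancel, ih] at h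
    simpa [hq0, zpow_ne_zero] using h.symm

lemma qTheta_ne_zero (hq : ‖q‖ < 1) (hq0 : q ≠ 0) {x : ℂ} (hx : x ≠ 0)
    (h : ∀ k : ℤ, x ≠ q ^ k) : qTheta q x ≠ 0 := by
  refine mul_ne_zero (qPochInf_ne_zero hq fun k hk => h (-k) ?_)
    (qPochInf_ne_zero hq fun k hk => h (k + 1) ?_)
  · rw [zpow_neg, zpow_natCast]; exact eq_inv_of_mul_eq_one_left hk
  · rw [zpow_add_one₀ hq0, zpow_natCast]
    field_simp at hk
    rw [← hk]; ring

lemma differentiableAt_qTheta (hq : ‖q‖ < 1) {x : ℂ} (hx : x ≠ 0) :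
    DifferentiableAt ℂ (qTheta q) x := by
  unfold qTheta
  exact (differentiable_qPochInf hq x).mul
    ((differentiable_qPochInf hq _).comp x (by fun_prop (disch := assumption)))

lemma hasDerivAt_qTheta_one (hq : ‖q‖ < 1) :
    HasDerivAt (qTheta q) (-(qPochInf q q) ^ 2) 1 := by
  have h : qTheta q = fun x => (1 - x) * (qPochInf q (q * x) * qPochInf q (q / x)) := by
    ext x; rw [qTheta, qPochInf_eq_mul hq x]; ring
  have hd : DifferentiableAt ℂ (fun x => qPochInf q (q * x) * qPochInf q (q / x)) 1 :=
    ((differentiable_qPochInf hq _).comp 1 (by fun_prop)).mul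
      ((differentiable_qPochInf hq _).comp 1 (by fun_prop (disch := simp)))
  rw [h]
  convert! ((hasDerivAt_id (1 : ℂ)).const_sub 1).mul hd.hasDerivAt using 1
  simp [sq]

lemma qPochInf_self_ne_zero (hq : ‖q‖ < 1) : qPochInf q q ≠ 0 :=
  qPochInf_ne_zero hq fun k hk => by
    have h : ‖q ^ (k + 1)‖ < 1 := by
      rw [norm_pow]; exact pow_lt_one₀ (norm_nonneg _) hq (by simp)
    rw [pow_succ', hk] at h
    simp at h

end Pochhammer

section Liouville

/-- An entire function with the multipliers `c` along `1` and `1` along the imaginary period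
`s * I` vanishes unless `c` is a positive real number. -/
lemma eq_zero_of_quasiperiodic {H : ℂ → ℂ} (hH : Differentiable ℂ H) {s : ℝ} (hs : s ≠ 0)
    {c : ℂ} (hc : ∀ r : ℝ, 0 ≤ r → c ≠ r) (h1 : ∀ z, H (z + 1) = c * H z)
    (h2 : ∀ z, H (z + s * Complex.I) = H z) (z : ℂ) : H z = 0 := by
  have hc0 : c ≠ 0 := by simpa using hc 0 le_rfl
  have hcn : 0 < ‖c‖ := norm_pos_iff.2 hc0
  set l : ℝ := Real.log ‖c‖
  have hexp : Real.exp l = ‖c‖ := Real.exp_log hcn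
  set K : ℂ → ℂ := fun z => Complex.exp (-(l * z)) * H z with hK
  have hKd : Differentiable ℂ K := by fun_prop
  have hp1 : Function.Periodic (fun z => ‖K z‖) 1 := fun z => by
    have : (-(l * (z + 1)) : ℂ).re = (-(l * z) : ℂ).re - l := by simp; ring
    simp only [hK, norm_mul, Complex.norm_exp, h1, this, Real.exp_sub, hexp]
    field_simp
  have hp2 : Function.Periodic (fun z => ‖K z‖) (s * Complex.I) := fun z => by
    have : (-(l * (z + s * Complex.I)) : ℂ).re = (-(l * z) : ℂ).re := by simp
    simp only [hK, norm_mul, Complex.norm_exp, h2, this]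
  obtain ⟨C, hC⟩ := ((isCompact_Icc (a := (0 : ℝ)) (b := 1)).prod
    (isCompact_Icc (a := (0 : ℝ)) (b := 1))).exists_bound_of_continuousOn
    (f := fun p : ℝ × ℝ => K (p.1 + p.2 * (s * Complex.I)))
    (hKd.continuous.comp (by fun_prop)).continuousOn
  have hbd : ∀ z, ‖K z‖ ≤ C := fun z => by
    obtain ⟨x, y, rfl⟩ : ∃ x y : ℝ, z = x + y * (s * Complex.I) := ⟨z.re, z.im / s, by
      apply Complex.ext
      · simp
      · simp; field_simp⟩
    have e1 := hp1.sub_zsmul_eq (x := x + y * (s * Complex.I)) ⌊x⌋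
    have e2 := hp2.sub_zsmul_eq (x := x + y * (s * Complex.I) - ⌊x⌋ • 1) ⌊y⌋
    have e3 : x + y * (s * Complex.I) - ⌊x⌋ • (1 : ℂ) - ⌊y⌋ • (s * Complex.I : ℂ) =
        (Int.fract x : ℝ) + (Int.fract y : ℝ) * (s * Complex.I) := by
      simp only [Int.fract, Complex.ofReal_sub, Complex.ofReal_intCast, zsmul_eq_mul]
      ring
    simp only [e3] at e2
    rw [← e1, ← e2]
    exact hC (Int.fract x, Int.fract y)
      ⟨⟨Int.fract_nonneg _, (Int.fract_lt_one _).le⟩, Int.fract_nonneg _, (Int.fract_lt_one _).le⟩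
  have hconst := hKd.apply_eq_apply_of_bounded
    (isBounded_iff_forall_norm_le.2 ⟨C, by rintro _ ⟨x, rfl⟩; exact hbd x⟩)
  have h0 : H 0 = 0 := by
    by_contra h0
    have e := hconst 1 0
    have e1 := h1 0
    simp only [zero_add] at e1
    simp only [hK, e1, mul_one, mul_zero, neg_zero, Complex.exp_zero, one_mul] at e
    have e' : Complex.exp (-l) * c = 1 := by
      apply mul_right_cancel₀ h0; rw [mul_assoc, e, one_mul]
    apply hc (Real.exp l) (Real.exp_pos _).le
    rw [Complex.exp_neg] at e'
    have := Complex.exp_ne_zero l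
    field_simp at e'
    rw [e']; simp
  have := hconst z 0
  simpa [hK, h0] using this

/-- A function holomorphic off a closed set of isolated points, with removable singularities,
has an entire extension. -/
lemma exists_entire_extension {D : ℂ → ℂ} {Ω : Set ℂ} (hΩo : IsOpen Ω)
    (hΩ : ∀ z, ∀ᶠ x in 𝓝[≠] z, x ∈ Ω) (hD : DifferentiableOn ℂ D Ω)
    (ho : ∀ z ∉ Ω, Tendsto (fun x => (x - z) * D x) (𝓝[≠] z) (𝓝 0)) :
    ∃ E : ℂ → ℂ, Differentiable ℂ E ∧ EqOn E D Ω := by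
  have hE : ∀ z ∈ Ω, limUnder (𝓝[≠] z) D = D z := fun z hz =>
    ((hD.differentiableAt (hΩo.mem_nhds hz)).continuousAt.tendsto.mono_left
      nhdsWithin_le_nhds).limUnder_eq
  refine ⟨fun z => limUnder (𝓝[≠] z) D, fun z => ?_, hE⟩
  by_cases hz : z ∈ Ω
  · refine (hD.differentiableAt (hΩo.mem_nhds hz)).congr_of_eventuallyEq ?_
    filter_upwards [hΩo.mem_nhds hz] with x hx using hE x hx
  · have hlo : (fun x => D x - D z) =o[𝓝[≠] z] fun x => (x - z)⁻¹ := by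
      rw [Asymptotics.isLittleO_iff_tendsto']
      · have h2 : Tendsto (fun x => (x - z) * D z) (𝓝[≠] z) (𝓝 0) := by
          have : Tendsto (fun x => (x - z) * D z) (𝓝 z) (𝓝 ((z - z) * D z)) :=
            (by fun_prop : Continuous fun x => (x - z) * D z).tendsto z
          simpa using this.mono_left nhdsWithin_le_nhds
        have := (ho z hz).sub h2
        rw [sub_zero] at this
        refine this.congr fun x => ?_
        rw [div_inv_eq_mul]; ring
      · filter_upwards [self_mem_nhdsWithin] with x hx h
        exact absurd h (inv_ne_zero (sub_ne_zero.2 hx))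
    have hu := Complex.differentiableOn_update_limUnder_insert_of_isLittleO (hΩ z) hD hlo
    have hn : insert z Ω ∈ 𝓝 z := insert_mem_nhds_iff.2 (hΩ z)
    refine (hu.differentiableAt hn).congr_of_eventuallyEq ?_
    filter_upwards [hn] with x hx
    rcases hx with rfl | hx
    · simp
    · rw [Function.update_of_ne (by rintro rfl; exact hz hx)]; exact hE x hx

lemma eqOn_zero_of_quasiperiodic {D : ℂ → ℂ} {Ω : Set ℂ} (hΩo : IsOpen Ω)
    (hΩ : ∀ z, ∀ᶠ x in 𝓝[≠] z, x ∈ Ω) (hD : DifferentiableOn ℂ D Ω)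
    (ho : ∀ z ∉ Ω, Tendsto (fun x => (x - z) * D x) (𝓝[≠] z) (𝓝 0))
    {s : ℝ} (hs : s ≠ 0) {c : ℂ} (hc : ∀ r : ℝ, 0 ≤ r → c ≠ r)
    (hΩ1 : ∀ z ∈ Ω, z + 1 ∈ Ω) (hΩ2 : ∀ z ∈ Ω, z + s * Complex.I ∈ Ω)
    (h1 : ∀ z, D (z + 1) = c * D z) (h2 : ∀ z, D (z + s * Complex.I) = D z) :
    EqOn D 0 Ω := by
  obtain ⟨E, hEd, hED⟩ := exists_entire_extension hΩo hΩ hD ho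
  have hdense : Dense Ω := fun z =>
    mem_closure_iff_frequently.2 ((hΩ z).frequently.filter_mono nhdsWithin_le_nhds)
  have hEc := hEd.continuous
  have e1 : (fun z => E (z + 1)) = fun z => c * E z :=
    Continuous.ext_on hdense (by fun_prop) (by fun_prop) fun z hz => by
      simp only [hED hz, hED (hΩ1 z hz), h1]
  have e2 : (fun z => E (z + s * Complex.I)) = E :=
    Continuous.ext_on hdense (by fun_prop) (by fun_prop) fun z hz => by
      simp only [hED hz, hED (hΩ2 z hz), h2]
  intro z hz
  rw [← hED hz]
  exact eq_zero_of_quasiperiodic hEd hs hc (congrFun e1) (congrFun e2) z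

end Liouville

section Cosecant

open Complex

/-- The general term of the bilateral cosecant series. -/
noncomputable def cscTerm (w : ℝ) (L : ℂ) (m : ℤ) (z : ℂ) : ℂ :=
  (sin (z * Real.pi - 2 * (m : ℂ) * (Real.pi : ℂ) ^ 2 * I * (w : ℂ)⁻¹))⁻¹ *
    exp (2 * (m : ℂ) * Real.pi * I * (w : ℂ)⁻¹ * L) * exp (-z * L)

lemma exp_abs_im_le_norm_sin {u : ℂ} (hu : 1 ≤ |u.im|) : Real.exp |u.im| / 4 ≤ ‖sin u‖ := by
  have h1 : ‖sin u‖ = ‖exp (-u * I) - exp (u * I)‖ / 2 := by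
    rw [sin]; simp
  have h2 : |Real.exp u.im - Real.exp (-u.im)| ≤ ‖exp (-u * I) - exp (u * I)‖ := by
    simpa [norm_exp] using abs_norm_sub_norm_le (exp (-u * I)) (exp (u * I))
  have h3 : Real.exp |u.im| - Real.exp (-|u.im|) ≤ |Real.exp u.im - Real.exp (-u.im)| := by
    rcases abs_choice u.im with h | h <;> rw [h]
    · exact le_abs_self _
    · rw [neg_neg, abs_sub_comm]; exact le_abs_self _
  have h4 : Real.exp (-|u.im|) ≤ Real.exp |u.im| / 2 := by
    have h5 : 2 ≤ Real.exp (|u.im| + |u.im|) := by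
      linarith [Real.add_one_le_exp (|u.im| + |u.im|)]
    rw [Real.exp_add] at h5
    rw [Real.exp_neg, inv_eq_one_div, div_le_div_iff₀ (Real.exp_pos _) two_pos]
    linarith
  linarith

variable {w : ℝ} {L : ℂ}

lemma summable_exp_neg_mul_abs {δ : ℝ} (hδ : 0 < δ) :
    Summable fun m : ℤ => Real.exp (-δ * |(m : ℝ)|) := by
  have h : Summable fun n : ℕ => Real.exp (n * -δ) :=
    Real.summable_exp_nat_mul_iff.2 (neg_neg_of_pos hδ)
  apply Summable.of_nat_of_neg <;> simpa [mul_comm] using h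

lemma eventually_norm_cscTerm_le (hw : 0 < w) (L : ℂ) (R : ℝ) :
    ∀ᶠ m : ℤ in cofinite, ∀ z : ℂ, ‖z‖ ≤ R → ‖cscTerm w L m z‖ ≤
      4 * Real.exp (Real.pi * R + R * ‖L‖) *
        Real.exp (-(2 * Real.pi * (Real.pi - |L.im|) / w) * |(m : ℝ)|) := by
  have hpi := Real.pi_pos
  have ht : Tendsto (fun m : ℤ => |(m : ℝ)|) cofinite atTop := by
    rw [← cocompact_eq_cofinite]
    exact tendsto_norm_cocompact_atTop.congr Int.norm_eq_abs
  filter_upwards [ht.eventually_ge_atTop ((1 + Real.pi * R) * w / (2 * Real.pi ^ 2))]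
    with m hm z hz
  set u : ℂ := z * Real.pi - 2 * (m : ℂ) * (Real.pi : ℂ) ^ 2 * I * (w : ℂ)⁻¹ with hu
  have huim : u.im = Real.pi * z.im - 2 * Real.pi ^ 2 / w * m := by
    have : u = z * Real.pi - ((2 * Real.pi ^ 2 / w * m : ℝ) : ℂ) * I := by
      rw [hu]; push_cast; ring
    rw [this, sub_im, mul_comm z, im_ofReal_mul, im_ofReal_mul, I_im, mul_one]
  have hA : 1 + Real.pi * R ≤ 2 * Real.pi ^ 2 / w * |(m : ℝ)| := by
    rw [div_le_iff₀ (by positivity)] at hm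
    rw [div_mul_eq_mul_div, le_div_iff₀ hw]; linarith
  have hlow : 2 * Real.pi ^ 2 / w * |(m : ℝ)| - Real.pi * R ≤ |u.im| := by
    have h1 : |2 * Real.pi ^ 2 / w * (m : ℝ)| = 2 * Real.pi ^ 2 / w * |(m : ℝ)| := by
      rw [abs_mul, abs_of_pos (by positivity)]
    have h2 : |Real.pi * z.im| ≤ Real.pi * R := by
      rw [abs_mul, abs_of_pos hpi]
      exact mul_le_mul_of_nonneg_left ((abs_im_le_norm z).trans hz) hpi.le
    have h3 := abs_sub_abs_le_abs_sub (2 * Real.pi ^ 2 / w * (m : ℝ)) (Real.pi * z.im)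
    rw [abs_sub_comm, ← huim] at h3
    linarith
  have hsin : ‖(sin u)⁻¹‖ ≤
      4 * Real.exp (Real.pi * R - 2 * Real.pi ^ 2 / w * |(m : ℝ)|) := by
    have h1 := exp_abs_im_le_norm_sin (u := u) (by linarith)
    have h2 := Real.exp_le_exp.2 hlow
    rw [norm_inv, ← neg_sub, Real.exp_neg, ← div_eq_mul_inv]
    rw [inv_le_comm₀ (lt_of_lt_of_le (by positivity) h1) (by positivity), inv_div]
    linarith
  have he1 : ‖exp (2 * (m : ℂ) * Real.pi * I * (w : ℂ)⁻¹ * L)‖ ≤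
      Real.exp (2 * Real.pi / w * |L.im| * |(m : ℝ)|) := by
    have : 2 * (m : ℂ) * Real.pi * I * (w : ℂ)⁻¹ * L =
        ((2 * Real.pi / w * m : ℝ) : ℂ) * (I * L) := by push_cast; ring
    rw [norm_exp, this, re_ofReal_mul]
    apply Real.exp_le_exp.2
    simp only [I_mul_re]
    calc 2 * Real.pi / w * m * -L.im ≤ |2 * Real.pi / w * m * -L.im| := le_abs_self _
      _ = 2 * Real.pi / w * |L.im| * |(m : ℝ)| := by
        rw [abs_mul, abs_mul, abs_neg, abs_of_pos (by positivity : 0 < 2 * Real.pi / w)]; ring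
  have he2 : ‖exp (-z * L)‖ ≤ Real.exp (R * ‖L‖) := by
    refine (norm_exp_le_exp_norm _).trans (Real.exp_le_exp.2 ?_)
    rw [norm_mul, norm_neg]
    gcongr
  calc ‖cscTerm w L m z‖ = ‖(sin u)⁻¹‖ * ‖exp (2 * (m : ℂ) * Real.pi * I * (w : ℂ)⁻¹ * L)‖ *
        ‖exp (-z * L)‖ := by rw [cscTerm, norm_mul, norm_mul]
    _ ≤ 4 * Real.exp (Real.pi * R - 2 * Real.pi ^ 2 / w * |(m : ℝ)|) *
        Real.exp (2 * Real.pi / w * |L.im| * |(m : ℝ)|) * Real.exp (R * ‖L‖) := by gcongr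
    _ = _ := by
      simp only [mul_assoc (4 : ℝ), ← Real.exp_add]
      congr 2
      ring

variable (hw : 0 < w) (hL : |L.im| < Real.pi)
include hw hL

lemma summable_cscTerm_bound (C : ℝ) : Summable fun m : ℤ =>
    C * Real.exp (-(2 * Real.pi * (Real.pi - |L.im|) / w) * |(m : ℝ)|) :=
  (summable_exp_neg_mul_abs (div_pos (mul_pos (by positivity) (sub_pos.2 hL)) hw)).mul_left _

lemma summable_cscTerm (z : ℂ) : Summable fun m : ℤ => cscTerm w L m z :=
  (summable_cscTerm_bound hw hL _).of_norm_bounded_eventually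
    ((eventually_norm_cscTerm_le hw L ‖z‖).mono fun _ h => h z le_rfl)

lemma differentiableOn_tsum_cscTerm {χ : ℤ → ℂ} (hχ : ∀ m, ‖χ m‖ ≤ 1) {U : Set ℂ} (hU : IsOpen U)
    (hsin : ∀ m, χ m ≠ 0 → ∀ z ∈ U,
      sin (z * Real.pi - 2 * (m : ℂ) * (Real.pi : ℂ) ^ 2 * I * (w : ℂ)⁻¹) ≠ 0) :
    DifferentiableOn ℂ (fun z => ∑' m : ℤ, χ m * cscTerm w L m z) U := by
  have h : SummableLocallyUniformlyOn (fun (m : ℤ) z => χ m * cscTerm w L m z) U := by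
    refine .of_locally_bounded_eventually hU fun K _ hK => ?_
    obtain ⟨R, hR⟩ := hK.isBounded.exists_norm_le
    refine ⟨_, summable_cscTerm_bound hw hL (4 * Real.exp (Real.pi * R + R * ‖L‖)),
      (eventually_norm_cscTerm_le hw L R).mono fun m h z hz => ?_⟩
    rw [norm_mul]
    exact (mul_le_of_le_one_left (norm_nonneg _) (hχ m)).trans (h z (hR z hz))
  refine h.hasSumLocallyUniformlyOn.differentiableOn (.of_forall fun s => ?_) hU
  refine DifferentiableOn.fun_sum fun m _ => ?_
  by_cases hm : χ m = 0
  · simp [hm]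
  · unfold cscTerm
    have := hsin m hm
    fun_prop (disch := assumption)

omit hL in
lemma sin_eq_zero_iff_mem_lattice (z : ℂ) (m : ℤ) :
    sin (z * Real.pi - 2 * (m : ℂ) * (Real.pi : ℂ) ^ 2 * I * (w : ℂ)⁻¹) = 0 ↔
      ∃ k : ℤ, z = k + m * ((2 * Real.pi / w : ℝ) * I) := by
  have hpi : (Real.pi : ℂ) ≠ 0 := by exact_mod_cast Real.pi_ne_zero
  have hw0 : (w : ℂ) ≠ 0 := by exact_mod_cast hw.ne'
  rw [sin_eq_zero_iff]
  refine exists_congr fun k => ⟨fun h => ?_, fun h => ?_⟩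
  · apply mul_right_cancel₀ hpi
    push_cast
    rw [sub_eq_iff_eq_add] at h
    rw [h]; ring
  · rw [h]; push_cast; ring

omit hw hL in
lemma cscTerm_add_one (m : ℤ) (z : ℂ) : cscTerm w L m (z + 1) = -exp (-L) * cscTerm w L m z := by
  have h1 : (z + 1) * Real.pi - 2 * (m : ℂ) * (Real.pi : ℂ) ^ 2 * I * (w : ℂ)⁻¹ =
    (z * Real.pi - 2 * (m : ℂ) * (Real.pi : ℂ) ^ 2 * I * (w : ℂ)⁻¹) + Real.pi := by ring
  have h2 : -(z + 1) * L = -L + -z * L := by ring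
  rw [cscTerm, cscTerm, h1, h2, sin_add_pi, exp_add, inv_neg]
  ring

omit hw hL in
lemma cscTerm_add_period (m : ℤ) (z : ℂ) :
    cscTerm w L m (z + (2 * Real.pi / w : ℝ) * I) = cscTerm w L (m - 1) z := by
  simp only [cscTerm, mul_assoc (sin _)⁻¹, ← exp_add]
  have h1 : (z + (2 * Real.pi / w : ℝ) * I) * Real.pi -
      2 * (m : ℂ) * (Real.pi : ℂ) ^ 2 * I * (w : ℂ)⁻¹ =
      z * Real.pi - 2 * ((m - 1 : ℤ) : ℂ) * (Real.pi : ℂ) ^ 2 * I * (w : ℂ)⁻¹ := by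
    push_cast; ring
  have h2 : 2 * (m : ℂ) * Real.pi * I * (w : ℂ)⁻¹ * L + -(z + (2 * Real.pi / w : ℝ) * I) * L =
      2 * ((m - 1 : ℤ) : ℂ) * Real.pi * I * (w : ℂ)⁻¹ * L + -z * L := by
    push_cast; ring
  rw [h1, h2]

end Cosecant

section Lattice

open Complex

/-- The points off the lattice `ℤ + (2πi/w)ℤ`. -/
def offLattice (w : ℝ) : Set ℂ :=
  {z | ∀ k j : ℤ, z ≠ k + j * ((2 * Real.pi / w : ℝ) * I)}

lemma add_mem_offLattice {w : ℝ} {z : ℂ} (hz : z ∈ offLattice w) (k j : ℤ) :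
    z + (k + j * ((2 * Real.pi / w : ℝ) * I)) ∈ offLattice w := fun k' j' h => by
  apply hz (k' - k) (j' - j)
  rw [eq_sub_of_add_eq h]
  push_cast
  ring

variable {w : ℝ} (hw : 0 < w)
include hw

lemma norm_exp_neg_lt_one : ‖exp (-(w : ℂ))‖ < 1 := by
  rw [norm_exp]; simpa using hw

lemma exp_eq_zpow_iff (z : ℂ) (k : ℤ) : exp (-(w : ℂ) * z) = exp (-(w : ℂ)) ^ k ↔
    ∃ j : ℤ, z = k + j * ((2 * Real.pi / w : ℝ) * I) := by
  have hw0 : (w : ℂ) ≠ 0 := by exact_mod_cast hw.ne'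
  rw [← exp_int_mul, exp_eq_exp_iff_exists_int]
  constructor
  · rintro ⟨j, hj⟩
    refine ⟨-j, mul_left_cancel₀ (neg_ne_zero.2 hw0) ?_⟩
    rw [hj]; push_cast; field_simp; ring
  · rintro ⟨j, rfl⟩
    refine ⟨-j, ?_⟩
    push_cast; field_simp
    ring

lemma qTheta_exp_ne_zero_iff (z : ℂ) :
    qTheta (exp (-(w : ℂ))) (exp (-(w : ℂ) * z)) ≠ 0 ↔ z ∈ offLattice w := by
  constructor
  · intro h k j hz
    rw [(exp_eq_zpow_iff hw z k).2 ⟨j, hz⟩] at h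
    exact h (qTheta_zpow (norm_exp_neg_lt_one hw) (exp_ne_zero _) k)
  · intro h
    refine qTheta_ne_zero (norm_exp_neg_lt_one hw) (exp_ne_zero _) (exp_ne_zero _) fun k hk => ?_
    obtain ⟨j, hj⟩ := (exp_eq_zpow_iff hw z k).1 hk
    exact h k j hj

lemma differentiable_qTheta_exp_mul {Q : ℂ} (hQ : Q ≠ 0) :
    Differentiable ℂ fun z => qTheta (exp (-(w : ℂ))) (exp (-(w : ℂ) * z) * Q) := fun z =>
  (differentiableAt_qTheta (norm_exp_neg_lt_one hw) (mul_ne_zero (exp_ne_zero _) hQ)).comp z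
    (f := fun z => exp (-(w : ℂ) * z) * Q) (by fun_prop)

lemma differentiable_qTheta_exp :
    Differentiable ℂ fun z => qTheta (exp (-(w : ℂ))) (exp (-(w : ℂ) * z)) := by
  simpa using differentiable_qTheta_exp_mul hw one_ne_zero

lemma hasDerivAt_qTheta_exp_zero :
    HasDerivAt (fun z => qTheta (exp (-(w : ℂ))) (exp (-(w : ℂ) * z)))
      (w * qPochInf (exp (-(w : ℂ))) (exp (-(w : ℂ))) ^ 2) 0 := by
  have h1 : HasDerivAt (fun z : ℂ => exp (-(w : ℂ) * z)) (-w) 0 := by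
    simpa using ((hasDerivAt_id (0 : ℂ)).const_mul (-(w : ℂ))).cexp
  have h2 : HasDerivAt (qTheta (exp (-(w : ℂ))))
      (-(qPochInf (exp (-(w : ℂ))) (exp (-(w : ℂ)))) ^ 2) (exp (-(w : ℂ) * 0)) := by
    simpa using hasDerivAt_qTheta_one (norm_exp_neg_lt_one hw)
  convert! h2.comp (0 : ℂ) h1 using 1
  ring

lemma isOpen_offLattice : IsOpen (offLattice w) := by
  have : offLattice w = (fun z => qTheta (exp (-(w : ℂ))) (exp (-(w : ℂ) * z))) ⁻¹' {0}ᶜ := by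
    ext z; exact (qTheta_exp_ne_zero_iff hw z).symm
  rw [this]
  exact isOpen_compl_singleton.preimage (differentiable_qTheta_exp hw).continuous

omit hw in
lemma tendsto_sub_punctured_nhds (l : ℂ) : Tendsto (fun x => x - l) (𝓝[≠] l) (𝓝[≠] 0) := by
  refine tendsto_nhdsWithin_iff.2 ⟨?_, ?_⟩
  · have : Tendsto (fun x => x - l) (𝓝 l) (𝓝 (l - l)) :=
      (by fun_prop : Continuous fun x => x - l).tendsto l
    rw [sub_self] at this
    exact this.mono_left nhdsWithin_le_nhds
  · filter_upwards [self_mem_nhdsWithin] with x hx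
    exact sub_ne_zero.2 hx

lemma eventually_mem_offLattice (z : ℂ) : ∀ᶠ x in 𝓝[≠] z, x ∈ offLattice w := by
  by_cases hz : z ∈ offLattice w
  · exact nhdsWithin_le_nhds ((isOpen_offLattice hw).mem_nhds hz)
  · have h0 : ∀ᶠ x in 𝓝[≠] (0 : ℂ), x ∈ offLattice w := by
      have hne : (w : ℂ) * qPochInf (exp (-(w : ℂ))) (exp (-(w : ℂ))) ^ 2 ≠ 0 :=
        mul_ne_zero (by exact_mod_cast hw.ne')
          (pow_ne_zero _ (qPochInf_self_ne_zero (norm_exp_neg_lt_one hw)))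
      filter_upwards [(hasDerivAt_qTheta_exp_zero hw).eventually_ne (c := 0) hne] with x hx
      exact (qTheta_exp_ne_zero_iff hw x).1 hx
    simp only [offLattice, mem_ofPred_eq, not_forall, not_not] at hz
    obtain ⟨k, j, hkj⟩ := hz
    filter_upwards [(tendsto_sub_punctured_nhds z).eventually h0] with x hx
    have := add_mem_offLattice hx k j
    rwa [← hkj, sub_add_cancel] at this

end Lattice

section Evaluation

open Complex

lemma tendsto_mul_inv_of_hasDerivAt {f : ℂ → ℂ} {f' : ℂ} (hf : HasDerivAt f f' 0) (h0 : f 0 = 0)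
    (hf' : f' ≠ 0) : Tendsto (fun z => z * (f z)⁻¹) (𝓝[≠] 0) (𝓝 f'⁻¹) := by
  refine ((hasDerivAt_iff_tendsto_slope.1 hf).inv₀ hf').congr fun z => ?_
  simp [slope_def_field, h0, div_eq_mul_inv]

/-- The product side of the bilateral cosecant summation, as a function of `α`. -/
noncomputable def thetaQuotient (w : ℝ) (Q z : ℂ) : ℂ :=
  (w : ℂ) * qPochInf (exp (-(w : ℂ))) (exp (-(w : ℂ))) ^ 2 / (Real.pi * qTheta (exp (-(w : ℂ))) Q) *
    (qTheta (exp (-(w : ℂ))) (exp (-(w : ℂ) * z) * Q) *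
      (qTheta (exp (-(w : ℂ))) (exp (-(w : ℂ) * z)))⁻¹)

variable {w : ℝ} {Q L : ℂ} (hw : 0 < w)
include hw

lemma thetaQuotient_add_one (hQ : Q ≠ 0) (z : ℂ) :
    thetaQuotient w Q (z + 1) = Q⁻¹ * thetaQuotient w Q z := by
  have h1 : exp (-(w : ℂ) * (z + 1)) = exp (-(w : ℂ)) * exp (-(w : ℂ) * z) := by
    rw [← exp_add]; ring_nf
  have hq := norm_exp_neg_lt_one hw
  have ha := exp_ne_zero (-(w : ℂ) * z)
  unfold thetaQuotient
  rw [h1, mul_assoc _ _ Q, qTheta_mul hq (exp_ne_zero _) ha,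
    qTheta_mul hq (exp_ne_zero _) (mul_ne_zero ha hQ)]
  generalize exp (-(w : ℂ) * z) = a at *
  simp only [mul_inv, neg_mul, inv_neg, inv_inv]
  field_simp

lemma thetaQuotient_add_period (z : ℂ) :
    thetaQuotient w Q (z + (2 * Real.pi / w : ℝ) * I) = thetaQuotient w Q z := by
  have hw0 : (w : ℂ) ≠ 0 := by exact_mod_cast hw.ne'
  have h1 : exp (-(w : ℂ) * (z + (2 * Real.pi / w : ℝ) * I)) = exp (-(w : ℂ) * z) := by
    rw [exp_eq_exp_iff_exists_int]
    refine ⟨-1, ?_⟩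
    push_cast; field_simp; ring
  simp only [thetaQuotient, h1]

lemma differentiableOn_thetaQuotient (hQ : Q ≠ 0) :
    DifferentiableOn ℂ (thetaQuotient w Q) (offLattice w) :=
  ((differentiable_qTheta_exp_mul hw hQ).differentiableOn.mul
    ((differentiable_qTheta_exp hw).differentiableOn.inv
      fun z hz => (qTheta_exp_ne_zero_iff hw z).2 hz)).const_mul _

lemma tendsto_mul_thetaQuotient (hQ : Q ≠ 0) (hθ : qTheta (exp (-(w : ℂ))) Q ≠ 0) :
    Tendsto (fun z => z * thetaQuotient w Q z) (𝓝[≠] 0) (𝓝 (Real.pi : ℂ)⁻¹) := by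
  have hw0 : (w : ℂ) ≠ 0 := by exact_mod_cast hw.ne'
  have hpi : (Real.pi : ℂ) ≠ 0 := by exact_mod_cast Real.pi_ne_zero
  have hq := norm_exp_neg_lt_one hw
  have hP := qPochInf_self_ne_zero hq
  have h1 := tendsto_mul_inv_of_hasDerivAt (hasDerivAt_qTheta_exp_zero hw)
    (by simpa using qTheta_zpow hq (exp_ne_zero _) 0) (mul_ne_zero hw0 (pow_ne_zero _ hP))
  have h2 : Tendsto (fun z => qTheta (exp (-(w : ℂ))) (exp (-(w : ℂ) * z) * Q)) (𝓝[≠] 0)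
      (𝓝 (qTheta (exp (-(w : ℂ))) Q)) := by
    have := (differentiable_qTheta_exp_mul hw hQ).continuous.tendsto 0
    simp only [mul_zero, exp_zero, one_mul] at this
    exact this.mono_left nhdsWithin_le_nhds
  have h3 := (h2.mul h1).const_mul ((w : ℂ) * qPochInf (exp (-(w : ℂ))) (exp (-(w : ℂ))) ^ 2 /
    (Real.pi * qTheta (exp (-(w : ℂ))) Q))
  convert! h3 using 2
  · simp only [thetaQuotient]; ring
  · field_simp

omit hw in
lemma tsum_cscTerm_add_one (hL : exp L = -Q) (z : ℂ) :
    ∑' m : ℤ, cscTerm w L m (z + 1) = Q⁻¹ * ∑' m : ℤ, cscTerm w L m z := by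
  have : -exp (-L) = Q⁻¹ := by rw [exp_neg, hL, inv_neg, neg_neg]
  simp only [cscTerm_add_one, tsum_mul_left, this]

omit hw in
lemma tsum_cscTerm_add_period (z : ℂ) :
    ∑' m : ℤ, cscTerm w L m (z + (2 * Real.pi / w : ℝ) * I) = ∑' m : ℤ, cscTerm w L m z := by
  simp only [cscTerm_add_period]
  exact (Equiv.subRight (1 : ℤ)).tsum_eq fun m => cscTerm w L m z

lemma tendsto_mul_tsum_cscTerm (hL : |L.im| < Real.pi) :
    Tendsto (fun z => z * ∑' m : ℤ, cscTerm w L m z) (𝓝[≠] 0) (𝓝 (Real.pi : ℂ)⁻¹) := by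
  have hpi : (Real.pi : ℂ) ≠ 0 := by exact_mod_cast Real.pi_ne_zero
  have hs : 0 < 2 * Real.pi / w := div_pos (by positivity) hw
  have hd := differentiableOn_tsum_cscTerm hw hL (χ := fun m => if m = 0 then 0 else 1)
    (fun m => by split_ifs <;> simp) (Metric.isOpen_ball (x := (0 : ℂ)) (ε := 2 * Real.pi / w))
    (fun m hm z hz => by
      have hm0 : m ≠ 0 := by rintro rfl; simp at hm
      rw [Ne, sin_eq_zero_iff_mem_lattice hw]
      rintro ⟨k, rfl⟩
      have h1 := abs_im_le_norm ((k : ℂ) + m * ((2 * Real.pi / w : ℝ) * I))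
      have h2 : ((k : ℂ) + m * ((2 * Real.pi / w : ℝ) * I)).im = m * (2 * Real.pi / w) := by
        rw [← ofReal_intCast m, add_im, im_ofReal_mul, im_ofReal_mul]; simp
      rw [h2, abs_mul, abs_of_pos hs] at h1
      have h3 : (1 : ℝ) ≤ |(m : ℝ)| := by exact_mod_cast Int.one_le_abs hm0
      have h4 := mem_ball_zero_iff.1 hz
      nlinarith)
  set F := fun z => ∑' m : ℤ, (if m = 0 then 0 else 1 : ℂ) * cscTerm w L m z with hF
  have h1 : Tendsto (fun z => z * F z) (𝓝[≠] 0) (𝓝 0) := by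
    have hc := (hd.differentiableAt (Metric.ball_mem_nhds 0 hs)).continuousAt.tendsto
    have := (tendsto_id (x := 𝓝 (0 : ℂ))).mul hc
    rw [zero_mul] at this
    exact this.mono_left nhdsWithin_le_nhds
  have h2 : Tendsto (fun z => z * cscTerm w L 0 z) (𝓝[≠] 0) (𝓝 (Real.pi : ℂ)⁻¹) := by
    have hs : HasDerivAt (fun z : ℂ => sin (z * Real.pi)) Real.pi 0 := by
      simpa using ((hasDerivAt_id (0 : ℂ)).mul_const (Real.pi : ℂ)).csin
    have e1 := tendsto_mul_inv_of_hasDerivAt hs (by simp) hpi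
    have e2 : Tendsto (fun z => exp (-z * L)) (𝓝[≠] 0) (𝓝 1) := by
      have := (by fun_prop : Continuous fun z => exp (-z * L)).tendsto 0
      simp only [neg_zero, zero_mul, exp_zero] at this
      exact this.mono_left nhdsWithin_le_nhds
    have := e1.mul e2
    rw [mul_one] at this
    refine this.congr fun z => ?_
    simp [cscTerm, mul_assoc]
  have h3 := h2.add h1
  rw [add_zero] at h3
  refine h3.congr fun z => ?_
  rw [← mul_add, hF, (summable_cscTerm hw hL z).tsum_eq_add_tsum_ite 0]
  congr 2
  refine tsum_congr fun m => ?_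
  split_ifs <;> simp

/-- The bilateral cosecant series equals the theta quotient off its poles. -/
theorem tsum_cscTerm_eq_thetaQuotient (hL : |L.im| < Real.pi) (hexp : exp L = -Q)
    (hQ : ∀ r : ℝ, 0 ≤ r → Q ≠ r) (hθ : qTheta (exp (-(w : ℂ))) Q ≠ 0) {z : ℂ}
    (hz : z ∈ offLattice w) :
    ∑' m : ℤ, cscTerm w L m z = thetaQuotient w Q z := by
  have hQ0 : Q ≠ 0 := by simpa using hQ 0 le_rfl
  have hs : 2 * Real.pi / w ≠ 0 := (div_pos (by positivity) hw).ne'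
  set D : ℂ → ℂ := fun z => ∑' m : ℤ, cscTerm w L m z - thetaQuotient w Q z with hD
  have hD1 : ∀ z, D (z + 1) = Q⁻¹ * D z := fun z => by
    simp only [hD, tsum_cscTerm_add_one hexp, thetaQuotient_add_one hw hQ0, mul_sub]
  have hD2 : ∀ z, D (z + (2 * Real.pi / w : ℝ) * I) = D z := fun z => by
    simp only [hD, tsum_cscTerm_add_period, thetaQuotient_add_period hw]
  have hDk : ∀ (k : ℤ) z, D (z + k) = Q⁻¹ ^ k * D z := fun k => by
    induction k using Int.induction_on with
    | zero => simp
    | succ n ih =>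
      intro z
      push_cast at ih ⊢
      rw [← add_assoc, hD1, ih, zpow_add_one₀ (inv_ne_zero hQ0)]
      ring
    | pred n ih =>
      intro z
      have h := hD1 (z + ((-(n : ℤ) - 1 : ℤ) : ℂ))
      have e : z + ((-(n : ℤ) - 1 : ℤ) : ℂ) + 1 = z + ((-(n : ℤ) : ℤ) : ℂ) := by
        push_cast; ring
      rw [e, ih] at h
      rw [zpow_sub_one₀ (inv_ne_zero hQ0), inv_inv, mul_right_comm, h]
      field_simp
  have hd : DifferentiableOn ℂ D (offLattice w) := by
    refine DifferentiableOn.sub ?_ (differentiableOn_thetaQuotient hw hQ0)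
    have := differentiableOn_tsum_cscTerm hw hL (χ := fun _ => 1) (fun _ => by simp)
      (isOpen_offLattice hw) (fun m _ z hz h => by
        obtain ⟨k, hk⟩ := (sin_eq_zero_iff_mem_lattice hw z m).1 h
        exact hz k m hk)
    simpa using this
  have h0 : Tendsto (fun x => x * D x) (𝓝[≠] 0) (𝓝 0) := by
    have := (tendsto_mul_tsum_cscTerm hw hL).sub (tendsto_mul_thetaQuotient hw hQ0 hθ)
    rw [sub_self] at this
    exact this.congr fun x => (mul_sub _ _ _).symm
  have ho : ∀ z ∉ offLattice w, Tendsto (fun x => (x - z) * D x) (𝓝[≠] z) (𝓝 0) := by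
    intro z hz
    simp only [offLattice, mem_ofPred_eq, not_forall, not_not] at hz
    obtain ⟨k, j, hkj⟩ := hz
    have h := (h0.comp (tendsto_sub_punctured_nhds z)).const_mul (Q⁻¹ ^ k)
    rw [mul_zero] at h
    refine h.congr fun x => ?_
    have e : D x = Q⁻¹ ^ k * D (x - z) := by
      rw [← hDk]
      have := (Function.Periodic.int_mul (f := D) hD2 j) (x - z + k)
      rw [← this]
      congr 1
      rw [hkj]; ring
    simp only [Function.comp, e]
    ring
  have h := eqOn_zero_of_quasiperiodic (isOpen_offLattice hw) (eventually_mem_offLattice hw) hd ho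
    hs (c := Q⁻¹) (fun r hr h => hQ r⁻¹ (inv_nonneg.2 hr) (by
      rw [← inv_inv Q, h, ofReal_inv]))
    (fun z hz => by simpa using add_mem_offLattice hz 1 0)
    (fun z hz => by simpa using add_mem_offLattice hz 0 1) hD1 hD2 hz
  exact sub_eq_zero.1 h

end Evaluation

end QSeries

/-- the bilateral cosecant summation used in the Mellin–Barnes–Watson method.
Here `w > 0`, `q = e^{−w} ∈ (0,1)`, `a = q^α = e^{−wα} ∉ q^ℤ`, and `Q ∈ ℂ∖[0,∞)` with
`Q ∉ q^ℤ`; `(−Q)^{−α} = exp(−α log(−Q))` with the principal logarithm.  The bilateral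
series converges absolutely and has the stated product value. -/
theorem stmt_8 (w : ℝ) (hw : 0 < w) (q : ℝ) (hq : q = Real.exp (-w))
    (α : ℂ) (a : ℂ) (ha : a = Complex.exp (-(w : ℂ) * α))
    (haq : ∀ k : ℤ, a ≠ (q : ℂ) ^ k)
    (Q : ℂ) (hQray : ∀ r : ℝ, 0 ≤ r → Q ≠ (r : ℂ))
    (hQq : ∀ k : ℤ, Q ≠ (q : ℂ) ^ k) :
    Summable (fun m : ℤ => ‖(Complex.sin (α * Real.pi -
          2 * (m : ℂ) * (Real.pi : ℂ) ^ 2 * Complex.I * (w : ℂ)⁻¹))⁻¹ *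
        Complex.exp (2 * (m : ℂ) * Real.pi * Complex.I * (w : ℂ)⁻¹ * Complex.log (-Q)) *
        Complex.exp (-α * Complex.log (-Q))‖) ∧
      ∑' m : ℤ, (Complex.sin (α * Real.pi -
            2 * (m : ℂ) * (Real.pi : ℂ) ^ 2 * Complex.I * (w : ℂ)⁻¹))⁻¹ *
          Complex.exp (2 * (m : ℂ) * Real.pi * Complex.I * (w : ℂ)⁻¹ * Complex.log (-Q)) *
          Complex.exp (-α * Complex.log (-Q)) =
        (w : ℂ) * (qPochInf q q * qPochInf q q * qPochInf q (a * Q) *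
            qPochInf q ((q : ℂ) / (a * Q))) /
          ((Real.pi : ℂ) * (qPochInf q a * qPochInf q ((q : ℂ) / a) * qPochInf q Q *
            qPochInf q ((q : ℂ) / Q))) := by
  have hQ0 : Q ≠ 0 := by simpa using hQray 0 le_rfl
  have hqc : (q : ℂ) = Complex.exp (-(w : ℂ)) := by rw [hq]; push_cast; rfl
  have hL : |(Complex.log (-Q)).im| < Real.pi := by
    rw [Complex.log_im]
    refine lt_of_le_of_ne (Complex.abs_arg_le_pi _) fun h => ?_
    rcases abs_choice (-Q).arg with h' | h'
    · rw [h', Complex.arg_eq_pi_iff] at h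
      refine hQray Q.re (by simpa using h.1.le) (Complex.ext (by simp) ?_)
      simpa using h.2
    · linarith [Complex.neg_pi_lt_arg (-Q)]
  have hexp : Complex.exp (Complex.log (-Q)) = -Q := Complex.exp_log (neg_ne_zero.2 hQ0)
  have hq1 := QSeries.norm_exp_neg_lt_one hw
  rw [hqc] at haq hQq
  have hz : α ∈ QSeries.offLattice w := by
    rw [← QSeries.qTheta_exp_ne_zero_iff hw, ← ha]
    exact QSeries.qTheta_ne_zero hq1 (Complex.exp_ne_zero _) (ha ▸ Complex.exp_ne_zero _) haq
  have hθ := QSeries.qTheta_ne_zero hq1 (Complex.exp_ne_zero _) hQ0 hQq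
  refine ⟨(QSeries.summable_cscTerm hw hL α).norm, ?_⟩
  refine (QSeries.tsum_cscTerm_eq_thetaQuotient hw hL hexp hQray hθ hz).trans ?_
  rw [QSeries.thetaQuotient, ← ha, hqc]
  simp only [QSeries.qTheta, div_eq_mul_inv, mul_inv]
  ring
end

section
/- Fix q₀ ∈ (0,1) and for t ∈ (0,1] set q(t) = q₀^t. Then lim_{t→0⁺} (q(t) − 1) · ℓ_{q(t)}(Q) = Log Q uniformly on compact subsets of ℂ∖(−∞,0], where Log denotes the principal branch of the logarithm. -/
open Filter

/-- Jacobi's theta function `θ_q(Q) = Σ_{d∈ℤ} q^{d(d−1)/2} Q^d`. -/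
noncomputable def thetaFn (q Q : ℂ) : ℂ := ∑' d : ℤ, q ^ (d * (d - 1) / 2) * Q ^ d

/-- The q-logarithm `ℓ_q(Q) = −Q θ_q′(Q)/θ_q(Q)`. -/
noncomputable def qLog (q Q : ℂ) : ℂ := -Q * deriv (thetaFn q) Q / thetaFn q Q

/-- The closed negative real axis `(−∞,0] ⊆ ℂ`. -/
def negRay : Set ℂ := {z : ℂ | z.im = 0 ∧ z.re ≤ 0}

open Complex Topology

section ThetaCusp

variable {α : Type*} {l : Filter α} {w τ : α → ℂ} {b : ℝ}

lemma sq_sub_mul_abs_pos (hb : b < 1) {n : ℤ} (hn : n ≠ 0) :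
    0 < (n : ℝ) ^ 2 - b * |(n : ℝ)| := by
  have h : |(n : ℝ)| ≤ (n : ℝ) ^ 2 := by
    rw [← sq_abs]
    exact_mod_cast Int.le_self_sq |n|
  have h' : 0 < |(n : ℝ)| := by positivity
  nlinarith

lemma sq_sub_mul_abs_nonneg (hb : b < 1) (n : ℤ) : 0 ≤ (n : ℝ) ^ 2 - b * |(n : ℝ)| := by
  rcases eq_or_ne n 0 with rfl | hn
  · simp
  · exact (sq_sub_mul_abs_pos hb hn).le

lemma norm_jacobiTheta₂_term_le_of_im_le {z σ : ℂ} (hσ : 0 < σ.im) (hz : 2 * |z.im| ≤ b * σ.im)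
    (n : ℤ) :
    ‖jacobiTheta₂_term n z σ‖ ≤ Real.exp (-(Real.pi * ((n : ℝ) ^ 2 - b * |(n : ℝ)|) * σ.im)) := by
  refine (norm_jacobiTheta₂_term_le hσ (S := b * σ.im / 2) (by linarith) le_rfl n).trans_eq ?_
  push_cast
  ring_nf

lemma norm_jacobiTheta₂_term_le_of_one_le_im (hb : b < 1) {z σ : ℂ} (hσ : 1 ≤ σ.im)
    (hz : 2 * |z.im| ≤ b * σ.im) (n : ℤ) :
    ‖jacobiTheta₂_term n z σ‖ ≤ Real.exp (-Real.pi * (1 * n ^ 2 - 2 * (b / 2) * |n|)) := by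
  refine (norm_jacobiTheta₂_term_le_of_im_le (by linarith) hz n).trans (Real.exp_le_exp.mpr ?_)
  have h := mul_nonneg Real.pi_pos.le (sq_sub_mul_abs_nonneg hb n)
  push_cast
  nlinarith

lemma tendsto_jacobiTheta₂_term (hb : b < 1) (hτ : Tendsto (fun a ↦ (τ a).im) l atTop)
    (hw : ∀ᶠ a in l, 2 * |(w a).im| ≤ b * (τ a).im) {n : ℤ} (hn : n ≠ 0) :
    Tendsto (fun a ↦ jacobiTheta₂_term n (w a) (τ a)) l (𝓝 0) := by
  refine squeeze_zero_norm' (a := fun a ↦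
    Real.exp (-(Real.pi * ((n : ℝ) ^ 2 - b * |(n : ℝ)|) * (τ a).im))) ?_ ?_
  · filter_upwards [hw, hτ.eventually_gt_atTop 0] with a ha ha'
    exact norm_jacobiTheta₂_term_le_of_im_le ha' ha n
  · exact Real.tendsto_exp_neg_atTop_nhds_zero.comp
      (hτ.const_mul_atTop (mul_pos Real.pi_pos (sq_sub_mul_abs_pos hb hn)))

/-- `θ(w, τ) → 1` as `Im τ → ∞`, as long as `2 |Im w| ≤ b Im τ` for some `b < 1`. -/
lemma tendsto_jacobiTheta₂_one (hb : b < 1) (hτ : Tendsto (fun a ↦ (τ a).im) l atTop)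
    (hw : ∀ᶠ a in l, 2 * |(w a).im| ≤ b * (τ a).im) :
    Tendsto (fun a ↦ jacobiTheta₂ (w a) (τ a)) l (𝓝 1) := by
  rw [← tsum_ite_eq (0 : ℤ) (fun _ ↦ (1 : ℂ))]
  refine tendsto_tsum_of_dominated_convergence
    (by simpa using summable_pow_mul_jacobiTheta₂_term_bound (b / 2) one_pos 0) (fun n ↦ ?_) ?_
  · rcases eq_or_ne n 0 with rfl | hn
    · simpa [jacobiTheta₂_term] using tendsto_const_nhds
    · simpa [hn] using tendsto_jacobiTheta₂_term hb hτ hw hn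
  · filter_upwards [hw, hτ.eventually_ge_atTop 1] with a ha ha' n
    simpa using norm_jacobiTheta₂_term_le_of_one_le_im hb ha' ha n

/-- The derivative of `θ(w, τ)` in `w` tends to `0` as `Im τ → ∞`, as long as
`2 |Im w| ≤ b Im τ` for some `b < 1`. -/
lemma tendsto_jacobiTheta₂'_zero (hb : b < 1) (hτ : Tendsto (fun a ↦ (τ a).im) l atTop)
    (hw : ∀ᶠ a in l, 2 * |(w a).im| ≤ b * (τ a).im) :
    Tendsto (fun a ↦ jacobiTheta₂' (w a) (τ a)) l (𝓝 0) := by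
  rw [← tsum_zero (α := ℂ) (β := ℤ)]
  refine tendsto_tsum_of_dominated_convergence
    ((summable_pow_mul_jacobiTheta₂_term_bound (b / 2) one_pos 1).mul_left (2 * Real.pi))
    (fun n ↦ ?_) ?_
  · rcases eq_or_ne n 0 with rfl | hn
    · simpa [jacobiTheta₂'_term] using tendsto_const_nhds
    · simpa [jacobiTheta₂'_term] using
        (tendsto_jacobiTheta₂_term hb hτ hw hn).const_mul (2 * Real.pi * I * n)
  · filter_upwards [hw, hτ.eventually_ge_atTop 1] with a ha ha' n
    have h : ‖(2 * Real.pi * I * n : ℂ)‖ = 2 * Real.pi * (|n| : ℤ) := by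
      simp [abs_of_pos Real.pi_pos]
    rw [jacobiTheta₂'_term, norm_mul, h, pow_one, ← mul_assoc]
    exact mul_le_mul_of_nonneg_left (norm_jacobiTheta₂_term_le_of_one_le_im hb ha' ha n)
      (by positivity)

end ThetaCusp

lemma thetaFn_exp_neg (s : ℂ) {Q : ℂ} (hQ : Q ≠ 0) :
    thetaFn (exp (-s)) Q =
      jacobiTheta₂ ((log Q + s / 2) / (2 * Real.pi * I)) (I * s / (2 * Real.pi)) := by
  refine tsum_congr fun d ↦ ?_
  have hpi : (Real.pi : ℂ) ≠ 0 := ofReal_ne_zero.mpr Real.pi_ne_zero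
  have hd : ((d * (d - 1) / 2 : ℤ) : ℂ) = (d : ℂ) * (d - 1) / 2 := by
    rw [Int.cast_div (Int.even_mul_pred_self d).two_dvd (by norm_num)]
    push_cast
    rfl
  have hQd : Q ^ d = exp (d * log Q) := by rw [exp_int_mul, exp_log hQ]
  rw [jacobiTheta₂_term, hQd, ← exp_int_mul, ← exp_add, hd]
  congr 1
  field_simp
  rw [I_sq]
  ring

lemma hasDerivAt_thetaFn_exp_neg {s : ℝ} (hs : 0 < s) {Q : ℂ} (hQ : Q ∈ slitPlane) :
    HasDerivAt (thetaFn (exp (-s)))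
      (jacobiTheta₂' ((log Q + s / 2) / (2 * Real.pi * I)) (I * s / (2 * Real.pi)) *
        (Q⁻¹ / (2 * Real.pi * I))) Q := by
  have him : 0 < (I * s / (2 * Real.pi) : ℂ).im := by
    rw [show (I * s / (2 * Real.pi) : ℂ) = (s / (2 * Real.pi) : ℝ) * I by push_cast; ring,
      im_ofReal_mul, I_im]
    have := Real.pi_pos
    positivity
  have h := (hasDerivAt_jacobiTheta₂_fst ((log Q + s / 2) / (2 * Real.pi * I)) him).comp Q
    (((hasDerivAt_log hQ).add_const (s / 2 : ℂ)).div_const (2 * Real.pi * I))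
  refine h.congr_of_eventuallyEq ?_
  filter_upwards [isOpen_slitPlane.mem_nhds hQ] with z hz
  exact thetaFn_exp_neg s (slitPlane_ne_zero hz)

/-- The modular transformation `τ ↦ -1 / τ` applied to the `q`-logarithm. -/
lemma qLog_exp_neg {s : ℝ} (hs : 0 < s) {Q : ℂ} (hQ : Q ∈ slitPlane)
    (h : jacobiTheta₂ (-(log Q + s / 2) / s) (2 * Real.pi * I / s) ≠ 0) :
    qLog (exp (-s)) Q = -(log Q + s / 2 - jacobiTheta₂' (-(log Q + s / 2) / s)
      (2 * Real.pi * I / s) / jacobiTheta₂ (-(log Q + s / 2) / s) (2 * Real.pi * I / s)) / s := by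
  have hpi : (Real.pi : ℂ) ≠ 0 := ofReal_ne_zero.mpr Real.pi_ne_zero
  have hs' : (s : ℂ) ≠ 0 := ofReal_ne_zero.mpr hs.ne'
  have hQ0 := slitPlane_ne_zero hQ
  have hI := I_ne_zero
  have hw : (log Q + s / 2) / (2 * Real.pi * I) / (I * s / (2 * Real.pi)) =
      -(log Q + s / 2) / s := by
    field_simp
    rw [I_sq]
    ring
  have hτ : -1 / (I * s / (2 * Real.pi)) = 2 * Real.pi * I / s := by
    field_simp
    rw [I_sq]
  rw [qLog, (hasDerivAt_thetaFn_exp_neg hs hQ).deriv, thetaFn_exp_neg _ hQ0,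
    jacobiTheta₂_functional_equation, jacobiTheta₂'_functional_equation, hw, hτ]
  have hc : 1 / (-I * (I * s / (2 * Real.pi))) ^ (1 / 2 : ℂ) *
      exp (-Real.pi * I * ((log Q + s / 2) / (2 * Real.pi * I)) ^ 2 / (I * s / (2 * Real.pi)))
        ≠ 0 := by
    refine mul_ne_zero (one_div_ne_zero ?_) (exp_ne_zero _)
    rw [Ne, cpow_eq_zero_iff]
    simp [hpi, hs', hI]
  generalize 1 / (-I * (I * s / (2 * Real.pi))) ^ (1 / 2 : ℂ) *
      exp (-Real.pi * I * ((log Q + s / 2) / (2 * Real.pi * I)) ^ 2 / (I * s / (2 * Real.pi)))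
        = c at hc ⊢
  generalize jacobiTheta₂ (-(log Q + s / 2) / s) (2 * Real.pi * I / s) = A at h ⊢
  generalize jacobiTheta₂' (-(log Q + s / 2) / s) (2 * Real.pi * I / s) = B
  field_simp
  rw [I_sq]
  ring

lemma compl_negRay : negRayᶜ = slitPlane := by
  ext z
  simp only [negRay, Set.mem_compl_iff, Set.mem_ofPred_eq, mem_slitPlane_iff]
  grind

lemma exists_abs_arg_le_of_isCompact {K : Set ℂ} (hK : K ⊆ slitPlane) (hKc : IsCompact K) :
    ∃ b < 1, ∀ Q ∈ K, |arg Q| ≤ b * Real.pi := by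
  rcases K.eq_empty_or_nonempty with rfl | hne
  · exact ⟨0, one_pos, by simp⟩
  · obtain ⟨Q₀, hQ₀, hmax⟩ := hKc.exists_isMaxOn hne (continuousOn_arg.mono hK).abs
    refine ⟨|arg Q₀| / Real.pi, ?_, fun Q hQ ↦ ?_⟩
    · rw [div_lt_one Real.pi_pos]
      exact (abs_arg_le_pi Q₀).lt_of_ne fun h ↦ by
        have := hK hQ₀
        rw [mem_slitPlane_iff_arg] at this
        rcases abs_eq Real.pi_pos.le |>.mp h with h | h
        · exact this.1 h
        · linarith [neg_pi_lt_arg Q₀]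
    · rw [div_mul_cancel₀ _ Real.pi_ne_zero]
      exact hmax hQ

lemma tendsto_one_sub_exp_neg_div :
    Tendsto (fun s : ℝ ↦ (1 - Real.exp (-s)) / s) (𝓝[>] 0) (𝓝 1) := by
  have h : HasDerivAt (fun s : ℝ ↦ 1 - Real.exp (-s)) 1 0 := by
    simpa using ((hasDerivAt_neg (0 : ℝ)).exp).const_sub 1
  refine (h.tendsto_slope_zero_right).congr fun s ↦ ?_
  simp [div_eq_inv_mul]

/-- The limit of the `q`-logarithm in the parametrization `q = exp (-s)`. -/
lemma tendstoUniformlyOn_qLog_exp_neg {K : Set ℂ} (hK : K ⊆ slitPlane) (hKc : IsCompact K) :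
    TendstoUniformlyOn (fun (s : ℝ) Q ↦ (exp (-s) - 1) * qLog (exp (-s)) Q) log (𝓝[>] 0) K := by
  obtain ⟨b, hb, hbK⟩ := exists_abs_arg_le_of_isCompact hK hKc
  obtain ⟨M, hM⟩ := hKc.exists_bound_of_continuousOn (f := log)
    (fun z hz ↦ (continuousAt_clog (hK hz)).continuousWithinAt)
  set l : Filter (ℝ × ℂ) := 𝓝[>] 0 ×ˢ 𝓟 K
  have hfst : Tendsto Prod.fst l (𝓝[>] (0 : ℝ)) := tendsto_fst
  have hpos : ∀ᶠ p : ℝ × ℂ in l, 0 < p.1 := hfst.eventually self_mem_nhdsWithin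
  have hmem : ∀ᶠ p : ℝ × ℂ in l, p.2 ∈ K := tendsto_snd.eventually (mem_principal_self K)
  have him (s : ℝ) : (2 * Real.pi * I / s : ℂ).im = 2 * Real.pi * s⁻¹ := by
    rw [show (2 * Real.pi * I / s : ℂ) = (2 * Real.pi * s⁻¹ : ℝ) * I by push_cast; ring,
      im_ofReal_mul, I_im, mul_one]
  have hτ : Tendsto (fun p : ℝ × ℂ ↦ (2 * Real.pi * I / p.1 : ℂ).im) l atTop := by
    simp_rw [him]
    exact (tendsto_inv_nhdsGT_zero.comp hfst).const_mul_atTop Real.two_pi_pos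
  have hw : ∀ᶠ p : ℝ × ℂ in l, 2 * |(-(log p.2 + p.1 / 2) / p.1 : ℂ).im| ≤
      b * (2 * Real.pi * I / p.1 : ℂ).im := by
    filter_upwards [hpos, hmem] with p hp hp'
    have h : (-(log p.2 + p.1 / 2) / p.1 : ℂ).im = -arg p.2 * p.1⁻¹ := by
      rw [div_ofReal_im, neg_im, add_im, log_im,
        show (p.1 / 2 : ℂ) = (p.1 / 2 : ℝ) by push_cast; rfl, ofReal_im, add_zero, div_eq_mul_inv]
    rw [h, him, abs_mul, abs_neg, abs_of_pos (inv_pos.mpr hp)]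
    nlinarith [mul_le_mul_of_nonneg_right (hbK _ hp') (inv_pos.mpr hp).le]
  have hJ := tendsto_jacobiTheta₂_one hb hτ hw
  have hR := (tendsto_jacobiTheta₂'_zero hb hτ hw).div hJ one_ne_zero
  have hA : Tendsto (fun p : ℝ × ℂ ↦ (((1 - Real.exp (-p.1)) / p.1 : ℝ) : ℂ)) l (𝓝 1) :=
    (continuous_ofReal.tendsto' 1 1 ofReal_one).comp (tendsto_one_sub_exp_neg_div.comp hfst)
  have hs : Tendsto (fun p : ℝ × ℂ ↦ (p.1 / 2 : ℂ)) l (𝓝 0) :=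
    ((by fun_prop : Continuous fun s : ℝ ↦ (s / 2 : ℂ)).tendsto' 0 0 (by simp)).comp
      (hfst.mono_right nhdsWithin_le_nhds)
  have hlog : IsBoundedUnder (· ≤ ·) l (norm ∘ fun p : ℝ × ℂ ↦ log p.2) :=
    isBoundedUnder_of_eventually_le (a := M) (hmem.mono fun p hp ↦ hM _ hp)
  have hlim := ((tendsto_sub_nhds_zero_iff.mpr hA).zero_mul_isBoundedUnder_le hlog).add
    (hA.mul (hs.sub hR))
  rw [tendstoUniformlyOn_iff_tendsto, uniformity_eq_comap_nhds_zero, tendsto_comap_iff]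
  rw [zero_div, sub_zero, mul_zero, add_zero] at hlim
  refine hlim.congr' ?_
  filter_upwards [hpos, hmem, hJ.eventually_ne one_ne_zero] with p hp hp' hp''
  have hp0 : (p.1 : ℂ) ≠ 0 := ofReal_ne_zero.mpr hp.ne'
  simp only [Function.comp_apply, Pi.div_apply]
  rw [qLog_exp_neg hp (hK hp') hp'']
  push_cast
  field_simp
  ring

/-- fix `q₀ ∈ (0,1)`, `q(t) = q₀^t`.  Then
`(q(t) − 1)·ℓ_{q(t)}(Q) → Log Q` as `t → 0⁺`, uniformly on compact subsets of
`ℂ∖(−∞,0]`, where `Log` is the principal branch of the logarithm. -/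
theorem stmt_15 (q₀ : ℝ) (hq₀ : q₀ ∈ Set.Ioo (0 : ℝ) 1) :
    ∀ K : Set ℂ, K ⊆ negRayᶜ → IsCompact K →
      TendstoUniformlyOn
        (fun (t : ℝ) (Q : ℂ) => (((q₀ ^ t : ℝ) : ℂ) - 1) * qLog ((q₀ ^ t : ℝ) : ℂ) Q)
        (fun Q => Complex.log Q) (nhdsWithin 0 (Set.Ioi 0)) K := by
  intro K hK hKc
  rw [compl_negRay] at hK
  have hlog : 0 < -Real.log q₀ := neg_pos.mpr (Real.log_neg hq₀.1 hq₀.2)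
  have hs : Tendsto (fun t : ℝ ↦ -Real.log q₀ * t) (𝓝[>] 0) (𝓝[>] 0) := by
    refine tendsto_nhdsWithin_iff.mpr ⟨?_, ?_⟩
    · exact ((by fun_prop : Continuous fun t : ℝ ↦ -Real.log q₀ * t).tendsto' 0 0
        (by simp)).mono_left nhdsWithin_le_nhds
    · filter_upwards [self_mem_nhdsWithin] with t ht using mul_pos hlog ht
  have hq (t : ℝ) : ((q₀ ^ t : ℝ) : ℂ) = exp (-((-Real.log q₀ * t : ℝ) : ℂ)) := by
    rw [Real.rpow_def_of_pos hq₀.1]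
    push_cast
    ring_nf
  simp_rw [hq]
  intro u hu
  exact hs.eventually (tendstoUniformlyOn_qLog_exp_neg hK hKc u hu)
end

section
/- Fix q₀ ∈ (0,1) and for t ∈ (0,1] set q(t) = q₀^t. Let Q₀ ∈ ℂ∖(−∞,0], let α₁, α₂ ∈ ℂ, and let Q₁(t), Q₂(t) be functions of t with Q_i(t) = Q₀ · q₀^{α_i t + o(t)} as t → 0⁺ (i = 1,2). Then lim_{t→0⁺} θ_{q(t)}(Q₁(t)) / θ_{q(t)}(Q₂(t)) = Q₀^{α₂−α₁} := exp((α₂ − α₁) · Log Q₀), where Log denotes the principal branch of the logarithm; moreover the convergence is uniform as Q₀ ranges over a compact subset of ℂ∖(−∞,0] (with the o(t) terms uniform in Q₀). -/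
open Filter

open Topology

lemma thetaFn_exp_eq_jacobiTheta₂ (h w : ℂ) :
    thetaFn (Complex.exp (-h)) (Complex.exp w) =
      jacobiTheta₂ ((w + h / 2) / (2 * Real.pi * Complex.I)) (Complex.I * h / (2 * Real.pi)) := by
  have hpi : (Real.pi : ℂ) ≠ 0 := by exact_mod_cast Real.pi_ne_zero
  unfold thetaFn jacobiTheta₂
  congr 1
  ext d
  rw [← Complex.exp_int_mul, ← Complex.exp_int_mul, ← Complex.exp_add, jacobiTheta₂_term]
  congr 1
  have h2 : (2 : ℤ) ∣ d * (d - 1) := (Int.even_mul_pred_self d).two_dvd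
  rw [Int.cast_div h2 (by norm_num)]
  push_cast
  field_simp
  rw [Complex.I_sq]
  ring

/-- The modular transformation of `θ_q(Q)` at `q = e^{-h}`, `Q = e^w`. -/
lemma thetaFn_exp_eq (h : ℝ) (hh : 0 < h) (w : ℂ) :
    thetaFn (Complex.exp (-h)) (Complex.exp w) =
      1 / ((h / (2 * Real.pi) : ℂ)) ^ (1 / 2 : ℂ) * Complex.exp ((w + h / 2) ^ 2 / (2 * h)) *
        jacobiTheta₂ (-(w + h / 2) / h) (2 * Real.pi * Complex.I / h) := by
  have hpi : (Real.pi : ℂ) ≠ 0 := by exact_mod_cast Real.pi_ne_zero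
  have hh' : (h : ℂ) ≠ 0 := by exact_mod_cast hh.ne'
  rw [thetaFn_exp_eq_jacobiTheta₂, jacobiTheta₂_functional_equation]
  congr 1
  · congr 2
    · congr 1
      rw [← mul_div_assoc, ← mul_assoc, neg_mul, Complex.I_mul_I]
      ring
    · field_simp
      rw [Complex.I_sq]
      ring
  · congr 1
    · field_simp
      rw [Complex.I_sq]
      ring
    · field_simp
      rw [Complex.I_sq]

lemma norm_jacobiTheta₂_term_inversion_le {h δ : ℝ} (hh : 0 < h) {w : ℂ} (hw : |w.im| ≤ Real.pi - δ)
    (n : ℤ) :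
    ‖jacobiTheta₂_term n (-(w + h / 2) / h) (2 * Real.pi * Complex.I / h)‖ ≤
      Real.exp (-(2 * Real.pi * δ * |(n : ℝ)|) / h) := by
  rw [norm_jacobiTheta₂_term, Real.exp_le_exp]
  have e1 : (-(w + h / 2) / h : ℂ).im = -w.im / h := by
    rw [Complex.div_ofReal_im]
    have : ((h : ℂ) / 2).im = 0 := by
      rw [show (h : ℂ) / 2 = ((h / 2 : ℝ) : ℂ) by push_cast; rfl, Complex.ofReal_im]
    simp [this]
  have e2 : (2 * Real.pi * Complex.I / h : ℂ).im = 2 * Real.pi / h := by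
    rw [Complex.div_ofReal_im]
    simp
  rw [e1, e2]
  have hn : |(n : ℝ)| ≤ (n : ℝ) ^ 2 := by
    rw [← sq_abs]
    rcases eq_or_ne n 0 with rfl | hn
    · simp
    · have : (1 : ℝ) ≤ |(n : ℝ)| := by exact_mod_cast Int.one_le_abs hn
      nlinarith
  have hnw : (n : ℝ) * w.im ≤ |(n : ℝ)| * (Real.pi - δ) :=
    (le_abs_self _).trans (by rw [abs_mul]; gcongr)
  rw [show -Real.pi * (n : ℝ) ^ 2 * (2 * Real.pi / h) - 2 * Real.pi * n * (-w.im / h) =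
    (2 * Real.pi * (n * w.im - Real.pi * (n : ℝ) ^ 2)) / h by ring]
  gcongr
  have := mul_le_mul_of_nonneg_left hn Real.pi_pos.le
  have h3 : (n : ℝ) * w.im - Real.pi * (n : ℝ) ^ 2 ≤ -(δ * |(n : ℝ)|) := by linarith
  have := mul_le_mul_of_nonneg_left h3 Real.two_pi_pos.le
  linarith

lemma summable_exp_neg_mul_abs_int {δ : ℝ} (hδ : 0 < δ) :
    Summable fun n : ℤ => Real.exp (-(δ * |(n : ℝ)|)) := by
  have h : Summable fun n : ℕ => Real.exp (-(δ * n)) := by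
    simpa [mul_comm] using Real.summable_exp_nat_mul_iff.mpr (neg_lt_zero.mpr hδ)
  exact Summable.of_nat_of_neg (by simpa using h) (by simpa using h)

lemma tendsto_jacobiTheta₂_one_s17 {ι : Type*} {l : Filter ι} {h : ι → ℝ} {w : ι → ℂ} {δ : ℝ}
    (hδ : 0 < δ) (hh : Tendsto h l (𝓝[>] 0)) (hw : ∀ᶠ i in l, |(w i).im| ≤ Real.pi - δ) :
    Tendsto (fun i => jacobiTheta₂ (-(w i + h i / 2) / h i) (2 * Real.pi * Complex.I / h i)) l
      (𝓝 1) := by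
  have hpos : ∀ᶠ i in l, 0 < h i := hh.eventually self_mem_nhdsWithin
  have hle : ∀ᶠ i in l, h i < 2 * Real.pi :=
    (hh.mono_right nhdsWithin_le_nhds).eventually (gt_mem_nhds Real.two_pi_pos)
  have key := tendsto_tsum_of_dominated_convergence (𝓕 := l)
    (f := fun i n => jacobiTheta₂_term n (-(w i + h i / 2) / h i) (2 * Real.pi * Complex.I / h i))
    (g := fun n => if n = 0 then 1 else 0) (summable_exp_neg_mul_abs_int hδ) ?_ ?_
  · rw [tsum_ite_eq] at key
    exact key
  · intro n
    rcases eq_or_ne n 0 with rfl | hn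
    · simpa [jacobiTheta₂_term] using tendsto_const_nhds
    simp only [hn, if_false]
    refine squeeze_zero_norm'
      (a := fun i => Real.exp (-(2 * Real.pi * δ * |(n : ℝ)|) / h i)) ?_ ?_
    · filter_upwards [hpos, hw] with i hi hwi using norm_jacobiTheta₂_term_inversion_le hi hwi n
    · have hn' : 0 < |(n : ℝ)| := by positivity
      have hc : -(2 * Real.pi * δ * |(n : ℝ)|) < 0 := by
        have := Real.pi_pos
        rw [neg_lt_zero]
        positivity
      simp only [div_eq_mul_inv]
      exact Real.tendsto_exp_atBot.comp
        ((tendsto_inv_nhdsGT_zero.comp hh).const_mul_atTop_of_neg hc)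
  · filter_upwards [hpos, hle, hw] with i hi hi' hwi n
    refine (norm_jacobiTheta₂_term_inversion_le hi hwi n).trans (Real.exp_le_exp.mpr ?_)
    rw [neg_div, neg_le_neg_iff, le_div_iff₀ hi]
    have : 0 ≤ δ * |(n : ℝ)| := by positivity
    nlinarith

lemma mem_slitPlane_of_notMem_negRay {z : ℂ} (hz : z ∈ negRayᶜ) : z ∈ Complex.slitPlane := by
  rw [Complex.mem_slitPlane_iff]
  by_contra! hc
  exact hz ⟨hc.2, hc.1⟩

lemma exists_abs_arg_le_pi_sub {K : Set ℂ} (hK : IsCompact K) (hKs : K ⊆ Complex.slitPlane) :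
    ∃ δ > 0, ∀ z ∈ K, |z.arg| ≤ Real.pi - δ := by
  rcases K.eq_empty_or_nonempty with rfl | hne
  · exact ⟨1, one_pos, by simp⟩
  have hc : ContinuousOn (fun z : ℂ => |z.arg|) K := fun z hz =>
    (Complex.continuousAt_arg (hKs hz)).abs.continuousWithinAt
  obtain ⟨z, hz, hmax⟩ := hK.exists_isMaxOn hne hc
  have hlt : |z.arg| < Real.pi :=
    (Complex.abs_arg_le_pi z).lt_of_ne fun h => by
      rcases eq_or_eq_neg_of_abs_eq h with h | h
      · exact Complex.slitPlane_arg_ne_pi (hKs hz) h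
      · exact (Complex.neg_pi_lt_arg z).ne' h
  exact ⟨Real.pi - |z.arg|, sub_pos.mpr hlt, fun y hy => by simpa using hmax hy⟩

/-- fix `q₀ ∈ (0,1)`, `q(t) = q₀^t`.  If
`Q_i(t) = Q₀ · q₀^{α_i t + ε_i(t,Q₀)}` with `ε_i(t,Q₀) = o(t)` as `t → 0⁺` (uniformly for
`Q₀` in a compact `K ⊆ ℂ∖(−∞,0]`, where `q₀^s = exp(s·ln q₀)`), then
`θ_{q(t)}(Q₁(t))/θ_{q(t)}(Q₂(t)) → Q₀^{α₂−α₁} = exp((α₂−α₁)·Log Q₀)` uniformly on `K`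
(pointwise convergence is the case of a singleton `K`). -/
theorem stmt_17 (q₀ : ℝ) (hq₀ : q₀ ∈ Set.Ioo (0 : ℝ) 1) (α₁ α₂ : ℂ)
    (ε₁ ε₂ : ℝ → ℂ → ℂ) (K : Set ℂ) (hK : IsCompact K) (hKs : K ⊆ negRayᶜ)
    (hε₁ : TendstoUniformlyOn (fun (t : ℝ) (Q₀ : ℂ) => ε₁ t Q₀ / (t : ℂ)) (fun _ => 0)
      (nhdsWithin 0 (Set.Ioi 0)) K)
    (hε₂ : TendstoUniformlyOn (fun (t : ℝ) (Q₀ : ℂ) => ε₂ t Q₀ / (t : ℂ)) (fun _ => 0)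
      (nhdsWithin 0 (Set.Ioi 0)) K) :
    TendstoUniformlyOn
      (fun (t : ℝ) (Q₀ : ℂ) =>
        thetaFn ((q₀ ^ t : ℝ) : ℂ) (Q₀ * Complex.exp ((α₁ * t + ε₁ t Q₀) * (Real.log q₀ : ℂ))) /
        thetaFn ((q₀ ^ t : ℝ) : ℂ) (Q₀ * Complex.exp ((α₂ * t + ε₂ t Q₀) * (Real.log q₀ : ℂ))))
      (fun Q₀ => Complex.exp ((α₂ - α₁) * Complex.log Q₀))
      (nhdsWithin 0 (Set.Ioi 0)) K := by
  have hL : 0 < -Real.log q₀ := neg_pos.mpr (Real.log_neg hq₀.1 hq₀.2)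
  have hKs' : K ⊆ Complex.slitPlane := fun z hz => mem_slitPlane_of_notMem_negRay (hKs hz)
  obtain ⟨δ, hδ, harg⟩ := exists_abs_arg_le_pi_sub hK hKs'
  have hlogc : ContinuousOn Complex.log K := fun z hz =>
    (continuousAt_clog (hKs' hz)).continuousWithinAt
  obtain ⟨M, hM⟩ := hK.exists_bound_of_continuousOn hlogc
  obtain ⟨B, hB⟩ := hK.exists_bound_of_continuousOn
    (f := fun z => Complex.exp ((α₂ - α₁) * Complex.log z))
    (Complex.continuous_exp.comp_continuousOn (continuousOn_const.mul hlogc))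
  set l : Filter (ℝ × ℂ) := 𝓝[>] (0 : ℝ) ×ˢ 𝓟 K with hl
  have hmem : ∀ᶠ p : ℝ × ℂ in l, p.2 ∈ K := tendsto_snd.eventually (mem_principal_self K)
  have hpos : ∀ᶠ p : ℝ × ℂ in l, 0 < p.1 := tendsto_fst.eventually self_mem_nhdsWithin
  let h : ℝ × ℂ → ℝ := fun p => -Real.log q₀ * p.1
  have hh0 : Tendsto h l (𝓝 0) := by
    have : Tendsto (fun p : ℝ × ℂ => p.1) l (𝓝 0) := tendsto_fst.mono_right nhdsWithin_le_nhds
    simpa [h] using this.const_mul (-Real.log q₀)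
  have hh : Tendsto h l (𝓝[>] 0) :=
    tendsto_nhdsWithin_iff.mpr ⟨hh0, hpos.mono fun p hp => mul_pos hL hp⟩
  have hhC : Tendsto (fun p => (h p : ℂ)) l (𝓝 0) := by
    simpa [Function.comp_def] using (Complex.continuous_ofReal.tendsto 0).comp hh0
  let β : ℂ → (ℝ → ℂ → ℂ) → ℝ × ℂ → ℂ := fun α ε p => α + ε p.1 p.2 / p.1
  let w : ℂ → (ℝ → ℂ → ℂ) → ℝ × ℂ → ℂ := fun α ε p => Complex.log p.2 - h p * β α ε p
  let J : ℂ → (ℝ → ℂ → ℂ) → ℝ × ℂ → ℂ := fun α ε p =>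
    jacobiTheta₂ (-(w α ε p + h p / 2) / h p) (2 * Real.pi * Complex.I / h p)
  have hβ : ∀ (α : ℂ) (ε : ℝ → ℂ → ℂ),
      TendstoUniformlyOn (fun (t : ℝ) (Q₀ : ℂ) => ε t Q₀ / (t : ℂ)) (fun _ => 0) (𝓝[>] 0) K →
      Tendsto (β α ε) l (𝓝 α) := fun α ε hε => by
    simpa [β, Function.HasUncurry.uncurry] using (tendsto_prod_principal_iff.mpr hε).const_add α
  have hJ : ∀ (α : ℂ) (ε : ℝ → ℂ → ℂ), Tendsto (β α ε) l (𝓝 α) →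
      Tendsto (J α ε) l (𝓝 1) := fun α ε hβ => by
    refine tendsto_jacobiTheta₂_one_s17 (half_pos hδ) hh ?_
    have h0 : Tendsto (fun p => (h p : ℂ) * β α ε p) l (𝓝 0) := by simpa using hhC.mul hβ
    have h1 : ∀ᶠ p in l, ‖(h p : ℂ) * β α ε p‖ < δ / 2 :=
      (tendsto_zero_iff_norm_tendsto_zero.mp h0).eventually (gt_mem_nhds (half_pos hδ))
    filter_upwards [h1, hmem] with p hp hpK
    have h2 := harg _ hpK
    have h3 := Complex.abs_im_le_norm ((h p : ℂ) * β α ε p)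
    have h4 : (w α ε p).im = p.2.arg - ((h p : ℂ) * β α ε p).im := by
      simp only [w, Complex.sub_im, Complex.log_im]
    rw [h4]
    exact (abs_sub _ _).trans (by linarith)
  have hθ : ∀ (α : ℂ) (ε : ℝ → ℂ → ℂ) (p : ℝ × ℂ), 0 < p.1 → p.2 ∈ K →
      thetaFn ((q₀ ^ p.1 : ℝ) : ℂ)
          (p.2 * Complex.exp ((α * p.1 + ε p.1 p.2) * (Real.log q₀ : ℂ))) =
        1 / ((h p / (2 * Real.pi) : ℂ)) ^ (1 / 2 : ℂ) *
          Complex.exp ((w α ε p + h p / 2) ^ 2 / (2 * h p)) * J α ε p := fun α ε p hp hpK => by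
    rw [← thetaFn_exp_eq _ (mul_pos hL hp)]
    have hp' : (p.1 : ℂ) ≠ 0 := by exact_mod_cast hp.ne'
    congr 1
    · rw [Real.rpow_def_of_pos hq₀.1]
      push_cast [h]
      ring_nf
    · rw [← Complex.exp_log (Complex.slitPlane_ne_zero (hKs' hpK)), ← Complex.exp_add,
        Complex.exp_log (Complex.slitPlane_ne_zero (hKs' hpK))]
      congr 1
      simp only [w, h, β]
      push_cast
      field_simp
      ring
  have hβ₁ := hβ α₁ ε₁ hε₁
  have hβ₂ := hβ α₂ ε₂ hε₂
  let E : ℝ × ℂ → ℂ := fun p =>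
    (β α₂ ε₂ p - β α₁ ε₁ p - (α₂ - α₁)) * Complex.log p.2 +
      (β α₂ ε₂ p - β α₁ ε₁ p) * h p * (1 - β α₁ ε₁ p - β α₂ ε₂ p) / 2
  have hE : Tendsto E l (𝓝 0) := by
    have h1 : Tendsto (fun p => (β α₂ ε₂ p - β α₁ ε₁ p - (α₂ - α₁)) * Complex.log p.2) l
        (𝓝 0) := by
      refine Tendsto.zero_mul_isBoundedUnder_le ?_ ?_
      · simpa using (hβ₂.sub hβ₁).sub_const (α₂ - α₁)
      · exact isBoundedUnder_of_eventually_le (a := M) (hmem.mono fun p hp => hM _ hp)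
    have h2 := (((hβ₂.sub hβ₁).mul hhC).mul ((hβ₁.const_sub 1).sub hβ₂)).div_const 2
    simpa using h1.add h2
  let R : ℝ × ℂ → ℂ := fun p => Complex.exp (E p) * (J α₁ ε₁ p / J α₂ ε₂ p)
  have hR : Tendsto R l (𝓝 1) := by
    simpa using ((Complex.continuous_exp.tendsto 0).comp hE).mul
      ((hJ α₁ ε₁ hβ₁).div (hJ α₂ ε₂ hβ₂) one_ne_zero)
  have hdiff : Tendsto (fun p : ℝ × ℂ => (1 - R p) * Complex.exp ((α₂ - α₁) * Complex.log p.2)) l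
      (𝓝 0) := by
    refine Tendsto.zero_mul_isBoundedUnder_le ?_ ?_
    · simpa using hR.const_sub 1
    · exact isBoundedUnder_of_eventually_le (a := B) (hmem.mono fun p hp => hB _ hp)
  rw [tendstoUniformlyOn_iff_tendsto, uniformity_eq_comap_nhds_zero_swapped, tendsto_comap_iff]
  refine hdiff.congr' ?_
  filter_upwards [hpos, hmem] with p hp hpK
  have hhp : (h p : ℂ) ≠ 0 := by exact_mod_cast (mul_pos hL hp).ne'
  have hC : 1 / ((h p / (2 * Real.pi) : ℂ)) ^ (1 / 2 : ℂ) ≠ 0 := by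
    refine one_div_ne_zero ?_
    rw [Ne, Complex.cpow_eq_zero_iff]
    exact fun hc => div_ne_zero hhp (by simp) hc.1
  simp only [Function.comp_apply]
  rw [hθ α₁ ε₁ p hp hpK, hθ α₂ ε₂ p hp hpK, mul_div_mul_comm, mul_div_mul_left _ _ hC,
    ← Complex.exp_sub, sub_mul, one_mul]
  congr 1
  simp only [R]
  rw [mul_right_comm, ← Complex.exp_add]
  congr 2
  simp only [E, w]
  field_simp
  ring
end
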